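/- arXiv:2007.06421 — 7 statements merged into one kernel-verified Lean document; each statement's English description precedes it below -/
import Mathlib

section
/- Let A and A' be automata and let P be a weakly adequate pre-product of A and A'. For any relations R and S between Sto and Sto', the automaton P satisfies the unary spec ⟨R,S⟩ in the basic semantics (regarding R and S as predicates on the stores Sto × Sto' of P) if and only if the pair A, A' satisfies the relational spec ⟨R,S⟩. (Theorem 1 of the paper.) -/
/-- An automaton: distinct initial and final controls, and a transition relation on
states (control–store pairs) satisfying finality and non-stuttering. -/
structure Automaton (Ctrl : Type*) (Sto : Type*) where
  init : Ctrl
  fin : Ctrl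
  init_ne_fin : init ≠ fin
  step : Ctrl × Sto → Ctrl × Sto → Prop
  finality : ∀ {γ β : Ctrl × Sto}, step γ β → γ.1 ≠ fin
  nonstutter : ∀ {γ β : Ctrl × Sto}, step γ β → γ.1 ≠ β.1

variable {Ctrl Sto Ctrl' Sto' : Type*}

/-- A trace: a nonempty finite sequence of states, consecutive under the transition
relation, whose first state has control `init`. -/
def Automaton.IsTrace (A : Automaton Ctrl Sto) (τ : List (Ctrl × Sto)) : Prop :=
  τ ≠ [] ∧ List.Chain' A.step τ ∧ ∀ h : τ ≠ [], (τ.head h).1 = A.init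

/-- A terminated trace: a trace whose last state has control `fin`. -/
def Automaton.IsTerminated (A : Automaton Ctrl Sto) (τ : List (Ctrl × Sto)) : Prop :=
  A.IsTrace τ ∧ ∀ h : τ ≠ [], (τ.getLast h).1 = A.fin

/-- A finite trace satisfies the spec ⟨P,Q⟩ in the basic semantics. -/
def Automaton.TraceSat (A : Automaton Ctrl Sto) (P Q : Sto → Prop)
    (τ : List (Ctrl × Sto)) : Prop :=
  ∀ h : τ ≠ [], P (τ.head h).2 → (τ.getLast h).1 = A.fin → Q (τ.getLast h).2

/-- An automaton satisfies the spec ⟨P,Q⟩ (basic semantics) iff all its finite traces do. -/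
def Automaton.Sat (A : Automaton Ctrl Sto) (P Q : Sto → Prop) : Prop :=
  ∀ τ, A.IsTrace τ → A.TraceSat P Q τ

/-- Traces τ of A and τ' of A' satisfy the relational spec ⟨R,S⟩. -/
def RelTraceSat (A : Automaton Ctrl Sto) (A' : Automaton Ctrl' Sto')
    (R S : Sto → Sto' → Prop)
    (τ : List (Ctrl × Sto)) (τ' : List (Ctrl' × Sto')) : Prop :=
  ∀ (h : τ ≠ []) (h' : τ' ≠ []),
    R (τ.head h).2 (τ'.head h').2 →
    (τ.getLast h).1 = A.fin → (τ'.getLast h').1 = A'.fin →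
    S (τ.getLast h).2 (τ'.getLast h').2

/-- The pair A, A' satisfies the relational spec ⟨R,S⟩ iff all pairs of finite traces do. -/
def RelSat (A : Automaton Ctrl Sto) (A' : Automaton Ctrl' Sto')
    (R S : Sto → Sto' → Prop) : Prop :=
  ∀ τ τ', A.IsTrace τ → A'.IsTrace τ' → RelTraceSat A A' R S τ τ'

/-- Remove from a list each element equal to its immediate predecessor. -/
noncomputable def destutter {α : Type*} (l : List α) : List α :=
  letI : DecidableRel (α := α) (· ≠ ·) := fun _ _ => Classical.propDecidable _
  List.destutter (· ≠ ·) l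

/-- The A-state component of a state of a product of A and A'. -/
def leftSt (γ : (Ctrl × Ctrl') × (Sto × Sto')) : Ctrl × Sto := (γ.1.1, γ.2.1)

/-- The A'-state component of a state of a product of A and A'. -/
def rightSt (γ : (Ctrl × Ctrl') × (Sto × Sto')) : Ctrl' × Sto' := (γ.1.2, γ.2.2)

/-- left(T) = destutter (map fst T). -/
noncomputable def leftTrace (T : List ((Ctrl × Ctrl') × (Sto × Sto'))) :
    List (Ctrl × Sto) :=
  destutter (T.map leftSt)

/-- right(T) = destutter (map snd T). -/
noncomputable def rightTrace (T : List ((Ctrl × Ctrl') × (Sto × Sto'))) :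
    List (Ctrl' × Sto') :=
  destutter (T.map rightSt)

/-- P is a pre-product of A and A': an automaton on control set Ctrl × Ctrl' and
store set Sto × Sto', with initial control (init, init'), final control (fin, fin'),
whose transition relation is contained in (↦ ⊗ ↦') ∪ (↦ ⊗ id) ∪ (id ⊗ ↦'). -/
def IsPreProduct (A : Automaton Ctrl Sto) (A' : Automaton Ctrl' Sto')
    (P : Automaton (Ctrl × Ctrl') (Sto × Sto')) : Prop :=
  P.init = (A.init, A'.init) ∧ P.fin = (A.fin, A'.fin) ∧
  ∀ γ β, P.step γ β →
    (A.step (leftSt γ) (leftSt β) ∧ A'.step (rightSt γ) (rightSt β)) ∨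
    (A.step (leftSt γ) (leftSt β) ∧ rightSt γ = rightSt β) ∨
    (leftSt γ = leftSt β ∧ A'.step (rightSt γ) (rightSt β))

/-- Adequacy: every pair of finite traces of A and A' is covered by some trace of P. -/
def Adequate (A : Automaton Ctrl Sto) (A' : Automaton Ctrl' Sto')
    (P : Automaton (Ctrl × Ctrl') (Sto × Sto')) : Prop :=
  ∀ τ τ', A.IsTrace τ → A'.IsTrace τ' →
    ∃ T, P.IsTrace T ∧ τ <+: leftTrace T ∧ τ' <+: rightTrace T

/-- Weak adequacy: every pair of finite prefixes of terminated traces of A and A'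
(that are themselves traces) is covered by some trace of P. -/
def WeaklyAdequate (A : Automaton Ctrl Sto) (A' : Automaton Ctrl' Sto')
    (P : Automaton (Ctrl × Ctrl') (Sto × Sto')) : Prop :=
  ∀ τ τ', A.IsTrace τ → A'.IsTrace τ' →
    (∃ σ, A.IsTerminated σ ∧ τ <+: σ) →
    (∃ σ', A'.IsTerminated σ' ∧ τ' <+: σ') →
    ∃ T, P.IsTrace T ∧ τ <+: leftTrace T ∧ τ' <+: rightTrace T

/-- No stuck states: every state whose control is not fin has a successor. -/
def NoStuck (A : Automaton Ctrl Sto) : Prop :=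
  ∀ γ : Ctrl × Sto, γ.1 ≠ A.fin → ∃ β, A.step γ β

/-- Only-lockstep transitions: both sides step. -/
def lockstepStep (A : Automaton Ctrl Sto) (A' : Automaton Ctrl' Sto')
    (γ β : (Ctrl × Ctrl') × (Sto × Sto')) : Prop :=
  A.step (leftSt γ) (leftSt β) ∧ A'.step (rightSt γ) (rightSt β)

/-- Interleaved transitions: exactly one side steps. -/
def interleavedStep (A : Automaton Ctrl Sto) (A' : Automaton Ctrl' Sto')
    (γ β : (Ctrl × Ctrl') × (Sto × Sto')) : Prop :=
  (A.step (leftSt γ) (leftSt β) ∧ rightSt γ = rightSt β) ∨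
  (leftSt γ = leftSt β ∧ A'.step (rightSt γ) (rightSt β))

section Destutter

variable {α : Type*} {r : α → α → Prop}

/-- Destuttering a chain for the reflexive closure of `r` yields an `r`-chain with the same
endpoints. -/
theorem List.IsChain.destutter'_ne [DecidableRel (fun a b : α => a ≠ b)] (l : List α) :
    ∀ a, List.IsChain (fun x y => r x y ∨ x = y) (a :: l) →
      List.IsChain r (List.destutter' (· ≠ ·) a l) ∧
      (List.destutter' (· ≠ ·) a l).head? = some a ∧
      (List.destutter' (· ≠ ·) a l).getLast? = (a :: l).getLast? := by
  induction l with
  | nil => simp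
  | cons b l ih =>
    intro a hl
    rw [List.isChain_cons_cons] at hl
    obtain ⟨hc, hh, hg⟩ := ih b hl.2
    by_cases hab : a = b
    · subst hab
      rw [List.destutter'_cons_neg _ (by simp)]
      exact ⟨hc, hh, by simp [hg]⟩
    · rw [List.destutter'_cons_pos _ hab]
      refine ⟨?_, by simp, ?_⟩
      · rw [List.isChain_cons]
        refine ⟨fun y hy => ?_, hc⟩
        rw [hh] at hy
        obtain rfl : b = y := by simpa using hy
        exact hl.1.resolve_right hab
      · rw [List.getLast?_cons, hg]
        simp [List.getLast?_cons]

theorem isChain_destutter {l : List α}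
    (hl : List.IsChain (fun x y => r x y ∨ x = y) l) :
    List.IsChain r (destutter l) ∧ (destutter l).head? = l.head? ∧
      (destutter l).getLast? = l.getLast? := by
  cases l with
  | nil => simp [destutter]
  | cons a l =>
    let _ : DecidableRel (fun a b : α => a ≠ b) := fun _ _ => Classical.propDecidable _
    exact List.IsChain.destutter'_ne l a hl

end Destutter

namespace Automaton

theorem isTrace_iff_isChain_and_head (A : Automaton Ctrl Sto) (τ : List (Ctrl × Sto)) :
    A.IsTrace τ ↔ List.IsChain A.step τ ∧
      ∃ a, τ.head? = some a ∧ a.1 = A.init := by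
  constructor
  · rintro ⟨hne, hc, hi⟩
    exact ⟨hc, τ.head hne, List.head?_eq_some_head hne, hi hne⟩
  · rintro ⟨hc, a, ha, hi⟩
    refine ⟨by rintro rfl; simp at ha, hc, fun h => ?_⟩
    rw [List.head?_eq_some_head h, Option.some_inj] at ha
    rwa [ha]

/-- By finality, a terminated trace has no proper extension. -/
theorem IsTerminated.eq_of_prefix {A : Automaton Ctrl Sto} {τ σ : List (Ctrl × Sto)}
    (hτ : A.IsTerminated τ) (hσ : List.IsChain A.step σ) (h : τ <+: σ) : τ = σ := by
  obtain ⟨ρ, rfl⟩ := h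
  cases ρ with
  | nil => simp
  | cons c ρ =>
    have hne := hτ.1.1
    have := (List.isChain_append.1 hσ).2.2 _ (List.getLast?_eq_some_getLast hne) c (by simp)
    exact absurd (hτ.2 hne) (A.finality this)

end Automaton

section PreProduct

variable {A : Automaton Ctrl Sto} {A' : Automaton Ctrl' Sto'}
  {P : Automaton (Ctrl × Ctrl') (Sto × Sto')} {T : List ((Ctrl × Ctrl') × (Sto × Sto'))}

theorem IsPreProduct.leftTrace_spec (hpre : IsPreProduct A A' P) (hT : List.IsChain P.step T) :
    List.IsChain A.step (leftTrace T) ∧ (leftTrace T).head? = T.head?.map leftSt ∧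
      (leftTrace T).getLast? = T.getLast?.map leftSt := by
  rw [← List.head?_map, ← List.getLast?_map]
  refine isChain_destutter ((List.isChain_map _).2 (hT.imp fun γ β h => ?_))
  have := hpre.2.2 γ β h
  tauto

theorem IsPreProduct.rightTrace_spec (hpre : IsPreProduct A A' P) (hT : List.IsChain P.step T) :
    List.IsChain A'.step (rightTrace T) ∧ (rightTrace T).head? = T.head?.map rightSt ∧
      (rightTrace T).getLast? = T.getLast?.map rightSt := by
  rw [← List.head?_map, ← List.getLast?_map]
  refine isChain_destutter ((List.isChain_map _).2 (hT.imp fun γ β h => ?_))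
  have := hpre.2.2 γ β h
  tauto

/-- A trace of a pre-product projects to traces of both factors, with matching endpoints. -/
theorem IsPreProduct.projections (hpre : IsPreProduct A A' P) (hT : P.IsTrace T) :
    A.IsTrace (leftTrace T) ∧ A'.IsTrace (rightTrace T) ∧
      ∀ (h : T ≠ []) (hl : leftTrace T ≠ []) (hr : rightTrace T ≠ []),
        (leftTrace T).head hl = leftSt (T.head h) ∧
        (leftTrace T).getLast hl = leftSt (T.getLast h) ∧
        (rightTrace T).head hr = rightSt (T.head h) ∧
        (rightTrace T).getLast hr = rightSt (T.getLast h) := by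
  obtain ⟨lc, lh, ll⟩ := hpre.leftTrace_spec hT.2.1
  obtain ⟨rc, rh, rl⟩ := hpre.rightTrace_spec hT.2.1
  have hne := hT.1
  have hi : (T.head hne).1 = (A.init, A'.init) := (hT.2.2 hne).trans hpre.1
  rw [List.head?_eq_some_head hne, Option.map_some] at lh rh
  rw [List.getLast?_eq_some_getLast hne, Option.map_some] at ll rl
  refine ⟨(A.isTrace_iff_isChain_and_head _).2 ⟨lc, _, lh, by simp [leftSt, hi]⟩,
    (A'.isTrace_iff_isChain_and_head _).2 ⟨rc, _, rh, by simp [rightSt, hi]⟩,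
    fun h hl hr => ?_⟩
  rw [List.head?_eq_some_head hl, Option.some_inj] at lh
  rw [List.head?_eq_some_head hr, Option.some_inj] at rh
  rw [List.getLast?_eq_some_getLast hl, Option.some_inj] at ll
  rw [List.getLast?_eq_some_getLast hr, Option.some_inj] at rl
  exact ⟨lh, ll, rh, rl⟩

end PreProduct

/-- Theorem 1: a weakly adequate pre-product satisfies the unary spec ⟨R,S⟩
(basic semantics) iff the pair A, A' satisfies the relational spec ⟨R,S⟩. -/
theorem preproduct_sat_iff_relSat
    (A : Automaton Ctrl Sto) (A' : Automaton Ctrl' Sto')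
    (P : Automaton (Ctrl × Ctrl') (Sto × Sto'))
    (hpre : IsPreProduct A A' P) (hwa : WeaklyAdequate A A' P)
    (R S : Sto → Sto' → Prop) :
    P.Sat (fun st => R st.1 st.2) (fun st => S st.1 st.2) ↔ RelSat A A' R S := by
  constructor
  · intro hsat τ τ' hτ hτ' hne hne' hR hfin hfin'
    have ht : A.IsTerminated τ := ⟨hτ, fun _ => hfin⟩
    have ht' : A'.IsTerminated τ' := ⟨hτ', fun _ => hfin'⟩
    obtain ⟨T, hT, hl, hr⟩ :=
      hwa τ τ' hτ hτ' ⟨τ, ht, List.prefix_rfl⟩ ⟨τ', ht', List.prefix_rfl⟩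
    obtain ⟨hlT, hrT, hend⟩ := hpre.projections hT
    obtain rfl := ht.eq_of_prefix hlT.2.1 hl
    obtain rfl := ht'.eq_of_prefix hrT.2.1 hr
    obtain ⟨lh, ll, rh, rl⟩ := hend hT.1 hne hne'
    rw [lh, rh] at hR
    rw [ll] at hfin
    rw [rl] at hfin'
    rw [ll, rl]
    exact hsat T hT hT.1 hR (hpre.2.1 ▸ Prod.ext hfin hfin')
  · intro hrel T hT hne hR hfin
    obtain ⟨hlT, hrT, hend⟩ := hpre.projections hT
    obtain ⟨lh, ll, rh, rl⟩ := hend hne hlT.1 hrT.1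
    have hS := hrel _ _ hlT hrT hlT.1 hrT.1
    rw [hpre.2.1] at hfin
    rw [lh, ll, rh, rl] at hS
    exact hS hR (congrArg Prod.fst hfin) (congrArg Prod.snd hfin)
end

section
/- For any trace T of a pre-product of automata A and A', and any relations R and S between Sto and Sto': T satisfies the unary spec ⟨R,S⟩ in the basic semantics (regarding R and S as predicates on the pair stores Sto × Sto') if and only if the pair of traces left(T), right(T) satisfies the relational spec ⟨R,S⟩. -/
variable {Ctrl Sto Ctrl' Sto' : Type*}

theorem List.head?_destutter' {α : Type*} (r : α → α → Prop) [DecidableRel r]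
    (a : α) (l : List α) :
    (List.destutter' r a l).head? = some a := by
  induction l with
  | nil => rfl
  | cons b l ih =>
    by_cases h : r a b
    · rw [List.destutter'_cons_pos l h]
      rfl
    · rw [List.destutter'_cons_neg l h, ih]

theorem List.getLast?_destutter' {α : Type*} (r : α → α → Prop) [DecidableRel r]
    (hr : ∀ a b, ¬ r a b → a = b) (a : α) (l : List α) :
    (List.destutter' r a l).getLast? = (a :: l).getLast? := by
  induction l generalizing a with
  | nil => rfl
  | cons b l ih =>
    by_cases h : r a b
    · rw [List.destutter'_cons_pos l h, List.getLast?_cons, ih, List.getLast?_cons_cons]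
      simp [List.getLast?_cons]
    · obtain rfl := hr a b h
      rw [List.destutter'_cons_neg l h, ih, List.getLast?_cons_cons]

theorem head?_destutter {α : Type*} (l : List α) : (destutter l).head? = l.head? := by
  cases l with
  | nil => rfl
  | cons a l => exact @List.head?_destutter' _ _ (_) a l

theorem getLast?_destutter {α : Type*} (l : List α) :
    (destutter l).getLast? = l.getLast? := by
  cases l with
  | nil => rfl
  | cons a l => exact @List.getLast?_destutter' _ _ (_) (fun _ _ h => not_not.mp h) a l

theorem destutter_ne_nil {α : Type*} {l : List α} (h : l ≠ []) : destutter l ≠ [] := by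
  rwa [Ne, ← List.head?_eq_none_iff, head?_destutter, List.head?_eq_none_iff]

theorem head_destutter {α : Type*} {l : List α} (h : destutter l ≠ []) (h' : l ≠ []) :
    (destutter l).head h = l.head h' :=
  Option.some_injective _ (by
    rw [← List.head?_eq_some_head, ← List.head?_eq_some_head, head?_destutter])

theorem getLast_destutter {α : Type*} {l : List α} (h : destutter l ≠ []) (h' : l ≠ []) :
    (destutter l).getLast h = l.getLast h' :=
  Option.some_injective _ (by
    rw [← List.getLast?_eq_some_getLast, ← List.getLast?_eq_some_getLast, getLast?_destutter])

/-- A trace T of a pre-product satisfies the unary spec ⟨R,S⟩ (basic semantics)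
iff the pair left(T), right(T) satisfies the relational spec ⟨R,S⟩. -/
theorem traceSat_iff_relTraceSat
    (A : Automaton Ctrl Sto) (A' : Automaton Ctrl' Sto')
    (P : Automaton (Ctrl × Ctrl') (Sto × Sto'))
    (hpre : IsPreProduct A A' P)
    (T : List ((Ctrl × Ctrl') × (Sto × Sto'))) (hT : P.IsTrace T)
    (R S : Sto → Sto' → Prop) :
    P.TraceSat (fun st => R st.1 st.2) (fun st => S st.1 st.2) T ↔
      RelTraceSat A A' R S (leftTrace T) (rightTrace T) := by
  have hne : T ≠ [] := hT.1
  have hl : T.map leftSt ≠ [] := by simpa using hne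
  have hr : T.map rightSt ≠ [] := by simpa using hne
  have hfin : (T.getLast hne).1 = P.fin ↔
      (T.getLast hne).1.1 = A.fin ∧ (T.getLast hne).1.2 = A'.fin := by
    rw [hpre.2.1, Prod.ext_iff]
  have hrel : RelTraceSat A A' R S (leftTrace T) (rightTrace T) ↔
      (R (T.head hne).2.1 (T.head hne).2.2 → (T.getLast hne).1.1 = A.fin →
        (T.getLast hne).1.2 = A'.fin → S (T.getLast hne).2.1 (T.getLast hne).2.2) := by
    unfold RelTraceSat leftTrace rightTrace
    rw [forall_prop_of_true (destutter_ne_nil hl), forall_prop_of_true (destutter_ne_nil hr)]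
    rw [head_destutter _ hl, head_destutter _ hr, getLast_destutter _ hl,
      getLast_destutter _ hr, List.head_map, List.head_map, List.getLast_map,
      List.getLast_map]
    rfl
  rw [hrel, Automaton.TraceSat, forall_prop_of_true hne, hfin, and_imp]
end

section
/- For any trace T of a pre-product of automata A and A', the sequence left(T) is a trace of A and the sequence right(T) is a trace of A'. -/
variable {Ctrl Sto Ctrl' Sto' : Type*}

theorem exists_destutter'_eq_cons {α : Type*} [DecidableRel (α := α) (· ≠ ·)]
    {S : α → α → Prop} {l : List α} {a : α}
    (h : List.IsChain (fun x y => S x y ∨ x = y) (a :: l)) :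
    ∃ t, List.destutter' (· ≠ ·) a l = a :: t ∧ List.IsChain S (a :: t) := by
  induction l generalizing a with
  | nil => exact ⟨[], rfl, List.isChain_singleton a⟩
  | cons b l ih =>
    rw [List.isChain_cons_cons] at h
    obtain ⟨hab, hl⟩ := h
    by_cases hne : a = b
    · subst hne
      rw [List.destutter'_cons_neg (R := (· ≠ ·)) _ (by simp)]
      exact ih hl
    · obtain ⟨t, ht, hc⟩ := ih hl
      rw [List.destutter'_cons_pos (R := (· ≠ ·)) _ hne, ht]
      exact ⟨b :: t, rfl, List.isChain_cons_cons.2 ⟨hab.resolve_right hne, hc⟩⟩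

/-- Projecting a trace along a map that sends each transition to a transition or a stutter
yields, after destuttering, a trace. -/
theorem Automaton.IsTrace.destutter_map {C₁ S₁ C₂ S₂ : Type*} {P : Automaton C₁ S₁}
    {A : Automaton C₂ S₂} {f : C₁ × S₁ → C₂ × S₂}
    (hstep : ∀ γ β, P.step γ β → A.step (f γ) (f β) ∨ f γ = f β)
    (hinit : ∀ γ, γ.1 = P.init → (f γ).1 = A.init)
    {T : List (C₁ × S₁)} (hT : P.IsTrace T) : A.IsTrace (destutter (T.map f)) := by
  obtain ⟨hne, hchain, hhead⟩ := hT
  cases T with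
  | nil => exact absurd rfl hne
  | cons γ T =>
    let _ : DecidableRel (α := C₂ × S₂) (· ≠ ·) := fun _ _ => Classical.propDecidable _
    have hmap : List.IsChain (fun x y => A.step x y ∨ x = y) (f γ :: T.map f) :=
      (List.isChain_map f (l := γ :: T)).2 (List.IsChain.imp (fun a b h => hstep a b h) hchain)
    obtain ⟨t, ht, hc⟩ := exists_destutter'_eq_cons hmap
    have heq : destutter ((γ :: T).map f) = f γ :: t := ht
    rw [heq]
    exact ⟨List.cons_ne_nil _ _, hc, fun _ => hinit γ (hhead hne)⟩

/-- For a trace T of a pre-product of A and A', left(T) is a trace of A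
and right(T) is a trace of A'. -/
theorem left_right_of_preproduct_trace
    (A : Automaton Ctrl Sto) (A' : Automaton Ctrl' Sto')
    (P : Automaton (Ctrl × Ctrl') (Sto × Sto'))
    (hpre : IsPreProduct A A' P)
    (T : List ((Ctrl × Ctrl') × (Sto × Sto'))) (hT : P.IsTrace T) :
    A.IsTrace (leftTrace T) ∧ A'.IsTrace (rightTrace T) := by
  obtain ⟨hinit, -, hstep⟩ := hpre
  constructor
  · refine hT.destutter_map (f := leftSt) (fun γ β h => ?_) (fun γ h => ?_)
    · rcases hstep γ β h with h | h | h
      exacts [.inl h.1, .inl h.1, .inr h.1]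
    · simp [leftSt, h, hinit]
  · refine hT.destutter_map (f := rightSt) (fun γ β h => ?_) (fun γ h => ?_)
    · rcases hstep γ β h with h | h | h
      exacts [.inl h.2, .inr h.2, .inl h.2]
    · simp [rightSt, h, hinit]
end

section
/- For any automata A and A', the interleaved pre-product of A and A' is adequate. -/
variable {Ctrl Sto Ctrl' Sto' : Type*}

/-- The interleaved pre-product automaton. -/
def Automaton.interleaved (A : Automaton Ctrl Sto) (A' : Automaton Ctrl' Sto') :
    Automaton (Ctrl × Ctrl') (Sto × Sto') where
  init := (A.init, A'.init)
  fin := (A.fin, A'.fin)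
  init_ne_fin := fun h => A.init_ne_fin (congrArg Prod.fst h)
  step := interleavedStep A A'
  finality := by
    intro γ β h e
    unfold interleavedStep at h
    rcases h with ⟨h, -⟩ | ⟨-, h⟩
    · exact A.finality h (show γ.1.1 = A.fin by rw [e])
    · exact A'.finality h (show γ.1.2 = A'.fin by rw [e])
  nonstutter := by
    intro γ β h e
    unfold interleavedStep at h
    rcases h with ⟨h, -⟩ | ⟨-, h⟩
    · exact A.nonstutter h (show γ.1.1 = β.1.1 by rw [e])
    · exact A'.nonstutter h (show γ.1.2 = β.1.2 by rw [e])

theorem destutter_singleton {α : Type*} (a : α) : destutter [a] = [a] := by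
  simp [destutter]

theorem destutter_cons_cons_self {α : Type*} (a : α) (l : List α) :
    destutter (a :: a :: l) = destutter (a :: l) := by
  simp [destutter, List.destutter_cons']

theorem destutter_cons_cons_of_ne {α : Type*} {a b : α} (h : a ≠ b) (l : List α) :
    destutter (a :: b :: l) = a :: destutter (b :: l) := by
  simp [destutter, List.destutter_cons', h]

/-- The product state with components `γ` and `γ'`. -/
def pairSt (γ : Ctrl × Sto) (γ' : Ctrl' × Sto') : (Ctrl × Ctrl') × (Sto × Sto') :=
  ((γ.1, γ'.1), (γ.2, γ'.2))

@[simp] theorem leftSt_pairSt (γ : Ctrl × Sto) (γ' : Ctrl' × Sto') :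
    leftSt (pairSt γ γ') = γ := rfl

@[simp] theorem rightSt_pairSt (γ : Ctrl × Sto) (γ' : Ctrl' × Sto') :
    rightSt (pairSt γ γ') = γ' := rfl

theorem Automaton.ne_of_step (A : Automaton Ctrl Sto) {γ β : Ctrl × Sto}
    (h : A.step γ β) : γ ≠ β :=
  fun e => A.nonstutter h (congrArg Prod.fst e)

/-- Two runs are jointly realised by an interleaved run: first the left one, then the
right one. -/
theorem exists_interleaved_run (A : Automaton Ctrl Sto) (A' : Automaton Ctrl' Sto')
    (γ' : Ctrl' × Sto') (l' : List (Ctrl' × Sto')) (h' : List.IsChain A'.step (γ' :: l'))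
    (γ : Ctrl × Sto) (l : List (Ctrl × Sto)) (h : List.IsChain A.step (γ :: l)) :
    ∃ T, List.IsChain (interleavedStep A A') (pairSt γ γ' :: T) ∧
      leftTrace (pairSt γ γ' :: T) = γ :: l ∧ rightTrace (pairSt γ γ' :: T) = γ' :: l' := by
  induction l generalizing γ with
  | nil =>
    induction l' generalizing γ' with
    | nil => exact ⟨[], by simp, by simp [leftTrace, destutter_singleton],
        by simp [rightTrace, destutter_singleton]⟩
    | cons β' l' ih =>
      rw [List.isChain_cons_cons] at h'
      obtain ⟨T, hT, hl, hr⟩ := ih β' h'.2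
      refine ⟨pairSt γ β' :: T, List.isChain_cons_cons.2 ⟨Or.inr ⟨rfl, h'.1⟩, hT⟩, ?_, ?_⟩
      · simpa [leftTrace, destutter_cons_cons_self] using hl
      · simpa [rightTrace, destutter_cons_cons_of_ne (A'.ne_of_step h'.1)] using hr
  | cons β l ih =>
    rw [List.isChain_cons_cons] at h
    obtain ⟨T, hT, hl, hr⟩ := ih β h.2
    refine ⟨pairSt β γ' :: T, List.isChain_cons_cons.2 ⟨Or.inl ⟨h.1, rfl⟩, hT⟩, ?_, ?_⟩
    · simpa [leftTrace, destutter_cons_cons_of_ne (A.ne_of_step h.1)] using hl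
    · simpa [rightTrace, destutter_cons_cons_self] using hr

/-- The interleaved pre-product of A and A' is adequate. -/
theorem interleaved_adequate
    (A : Automaton Ctrl Sto) (A' : Automaton Ctrl' Sto') :
    Adequate A A' (A.interleaved A') := by
  rintro (_ | ⟨γ, l⟩) (_ | ⟨γ', l'⟩) ⟨hne, hc, hi⟩ ⟨hne', hc', hi'⟩
  · exact absurd rfl hne
  · exact absurd rfl hne
  · exact absurd rfl hne'
  · obtain ⟨T, hT, hl, hr⟩ := exists_interleaved_run A A' γ' l' hc' γ l hc
    exact ⟨pairSt γ γ' :: T, ⟨by simp, hT, fun _ => Prod.ext (hi hne) (hi' hne')⟩,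
      hl ▸ List.prefix_rfl, hr ▸ List.prefix_rfl⟩
end

section
/- The only-lockstep pre-product is not adequate in general: let A be the automaton with control set {0,1}, init = 0, fin = 1, a one-element store set, and the single transition (0,s) ↦ (1,s); let A' be the automaton with control set {0,1,2}, init' = 0, fin' = 2, the same one-element store set, and transitions (0,s) ↦' (1,s) and (1,s) ↦' (2,s). Then the only-lockstep pre-product of A and A' is not adequate: for the terminated trace τ of A of length 2 and the terminated trace τ' of A' of length 3, no trace T of the only-lockstep pre-product has τ a prefix of left(T) and τ' a prefix of right(T). -/
variable {Ctrl Sto Ctrl' Sto' : Type*}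

/-- The only-lockstep pre-product automaton. -/
def Automaton.lockstep (A : Automaton Ctrl Sto) (A' : Automaton Ctrl' Sto') :
    Automaton (Ctrl × Ctrl') (Sto × Sto') where
  init := (A.init, A'.init)
  fin := (A.fin, A'.fin)
  init_ne_fin := fun h => A.init_ne_fin (congrArg Prod.fst h)
  step := lockstepStep A A'
  finality := by
    intro γ β h e
    unfold lockstepStep at h
    exact A.finality h.1 (show γ.1.1 = A.fin by rw [e])
  nonstutter := by
    intro γ β h e
    unfold lockstepStep at h
    exact A.nonstutter h.1 (show γ.1.1 = β.1.1 by rw [e])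

/-- A: control set {0,1}, init 0, fin 1, one-element store, single transition (0,s) ↦ (1,s). -/
def A10 : Automaton (Fin 2) Unit where
  init := 0
  fin := 1
  init_ne_fin := by decide
  step γ β := γ.1 = 0 ∧ β.1 = 1
  finality := by
    rintro γ β ⟨h0, -⟩ e
    rw [h0] at e
    exact absurd e (by decide)
  nonstutter := by
    rintro γ β ⟨h0, h1⟩ e
    rw [h0, h1] at e
    exact absurd e (by decide)

/-- A': control set {0,1,2}, init 0, fin 2, one-element store,
transitions (0,s) ↦ (1,s) and (1,s) ↦ (2,s). -/
def B10 : Automaton (Fin 3) Unit where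
  init := 0
  fin := 2
  init_ne_fin := by decide
  step γ β := (γ.1 = 0 ∧ β.1 = 1) ∨ (γ.1 = 1 ∧ β.1 = 2)
  finality := by
    rintro γ β (⟨h0, -⟩ | ⟨h0, -⟩) e <;> rw [h0] at e <;> exact absurd e (by decide)
  nonstutter := by
    rintro γ β (⟨h0, h1⟩ | ⟨h0, h1⟩) e <;> rw [h0, h1] at e <;> exact absurd e (by decide)

theorem length_destutter_le {α : Type*} (l : List α) : (destutter l).length ≤ l.length :=
  letI : DecidableRel (α := α) (· ≠ ·) := fun _ _ => Classical.propDecidable _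
  (List.destutter_sublist (· ≠ ·) l).length_le

theorem length_rightTrace_le (T : List ((Ctrl × Ctrl') × (Sto × Sto'))) :
    (rightTrace T).length ≤ T.length :=
  (length_destutter_le _).trans_eq (List.length_map _)

/-- Every successor state of `A10` has the final control, so lockstep runs stop after one step. -/
theorem length_le_two_of_isChain {T : List ((Fin 2 × Fin 3) × (Unit × Unit))}
    (hT : List.IsChain (A10.lockstep B10).step T) : T.length ≤ 2 := by
  match T, hT with
  | [], _ => simp
  | [_], _ => simp
  | [_, _], _ => simp
  | _ :: _ :: _ :: _, hT =>
    simp only [List.isChain_cons_cons] at hT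
    exact absurd hT.1.1.2 (A10.finality hT.2.1.1)

/-- The only-lockstep pre-product is not adequate in general: here the terminated
trace of A of length 2 and the terminated trace of A' of length 3 are covered by
no trace of the only-lockstep pre-product. -/
theorem lockstep_not_adequate :
    A10.IsTerminated [((0 : Fin 2), ()), ((1 : Fin 2), ())] ∧
    B10.IsTerminated [((0 : Fin 3), ()), ((1 : Fin 3), ()), ((2 : Fin 3), ())] ∧
    ¬ ∃ T, (A10.lockstep B10).IsTrace T ∧
        [((0 : Fin 2), ()), ((1 : Fin 2), ())] <+: leftTrace T ∧
        [((0 : Fin 3), ()), ((1 : Fin 3), ()), ((2 : Fin 3), ())] <+: rightTrace T := by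
  refine ⟨⟨⟨by simp, show List.IsChain _ _ by simp [A10], by simp [A10]⟩, by simp [A10]⟩,
    ⟨⟨by simp, show List.IsChain _ _ by simp [B10], by simp [B10]⟩, by simp [B10]⟩, ?_⟩
  rintro ⟨T, ⟨-, hT, -⟩, -, hright⟩
  have h := (hright.length_le.trans (length_rightTrace_le T)).trans (length_le_two_of_isChain hT)
  simp at h
end

section
/- Soundness of the inductive assertion method at the automaton level: let A be an automaton, let P and Q be store predicates, and let anno assign to each control point c ∈ Ctrl a store predicate such that (i) every store satisfying P satisfies anno(init), (ii) every store satisfying anno(fin) satisfies Q, and (iii) the set of states S = {(c,s) | s satisfies anno(c)} is closed under the transition relation ↦. Then A satisfies the spec ⟨P,Q⟩ in the basic semantics. -/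
variable {Ctrl Sto Ctrl' Sto' : Type*}

/-- A property preserved by a relation passes from the head of a chain to its last element. -/
theorem getLast_of_isChain {α : Type*} {r : α → α → Prop} {p : α → Prop}
    (hp : ∀ a b, p a → r a b → p b) :
    ∀ {l : List α} (h : l ≠ []), List.IsChain r l → p (l.head h) → p (l.getLast h)
  | [_], _, _, ha => ha
  | a :: b :: l, _, hc, ha => by
    rw [List.isChain_cons_cons] at hc
    rw [List.getLast_cons (List.cons_ne_nil b l)]
    exact getLast_of_isChain hp (List.cons_ne_nil b l) hc.2 (hp a b ha hc.1)

/-- Soundness of the inductive assertion method: if an annotation is implied by P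
at init, implies Q at fin, and determines a set of states closed under the
transition relation, then the automaton satisfies ⟨P,Q⟩ in the basic semantics. -/
theorem iam_sound
    (A : Automaton Ctrl Sto) (P Q : Sto → Prop) (anno : Ctrl → Sto → Prop)
    (hinit : ∀ s, P s → anno A.init s)
    (hfin : ∀ s, anno A.fin s → Q s)
    (hclosed : ∀ γ β : Ctrl × Sto, anno γ.1 γ.2 → A.step γ β → anno β.1 β.2) :
    A.Sat P Q := by
  rintro τ ⟨-, hchain, hhead⟩ h hP hlast
  have hanno : anno (τ.getLast h).1 (τ.getLast h).2 := by
    refine getLast_of_isChain (p := fun γ => anno γ.1 γ.2) hclosed h hchain ?_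
    rw [hhead h]
    exact hinit _ hP
  rw [hlast] at hanno
  exact hfin _ hanno
end

section
/- Relational soundness of the inductive assertion method via products: let A and A' be automata, let P be a weakly adequate pre-product of A and A', let R and S be relations between Sto and Sto', and let anno assign to each pair (c,c') ∈ Ctrl × Ctrl' a predicate on Sto × Sto' such that (i) every pair of stores related by R satisfies anno(init, init'), (ii) every pair of stores satisfying anno(fin, fin') is related by S, and (iii) the set of states of P whose store component satisfies the corresponding annotation is closed under the transition relation of P. Then the pair A, A' satisfies the relational spec ⟨R,S⟩. -/
variable {Ctrl Sto Ctrl' Sto' : Type*}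

/-- A prefix of the destuttering of a path of a reflexive closure that ends in a stuck
element is the whole destuttering: its endpoints are those of the path. -/
theorem head_getLast_eq_of_prefix_destutter {α : Type*} {r : α → α → Prop} {l τ : List α}
    (hl : List.IsChain (fun x y => r x y ∨ x = y) l) (hτ : τ <+: destutter l)
    (hne : τ ≠ []) (hl₀ : l ≠ []) (hstuck : ∀ y, ¬ r (τ.getLast hne) y) :
    τ.head hne = l.head hl₀ ∧ τ.getLast hne = l.getLast hl₀ := by
  induction l generalizing τ with
  | nil => exact absurd rfl hl₀
  | cons a l ih =>
    obtain ⟨x, τ, rfl⟩ := List.exists_cons_of_ne_nil hne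
    cases l with
    | nil =>
      simp only [destutter, List.destutter_singleton, List.cons_prefix_cons,
        List.prefix_nil] at hτ
      obtain ⟨rfl, rfl⟩ := hτ
      simp
    | cons b l =>
      rw [List.isChain_cons_cons] at hl
      by_cases hab : a = b
      · subst hab
        have hτ' : x :: τ <+: destutter (a :: l) := by
          simpa [destutter, List.destutter_cons_cons, List.destutter_cons'] using hτ
        simpa using ih hl.2 hτ' hne (by simp) hstuck
      · have hτ' : x :: τ <+: a :: destutter (b :: l) := by
          simpa [destutter, List.destutter_cons_cons, List.destutter_cons', hab] using hτ
        obtain ⟨rfl, hτb⟩ := List.cons_prefix_cons.mp hτ'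
        rcases eq_or_ne τ [] with rfl | hτ₀
        · exact absurd (hl.1.resolve_right hab) (hstuck b)
        · simp only [List.getLast_cons hτ₀] at hstuck ⊢
          exact ⟨rfl, (ih hl.2 hτb hτ₀ (by simp) hstuck).2⟩

/-- A property preserved by a relation passes from the head of a chain to its last element. -/
theorem List.IsChain.getLast_of_head {α : Type*} {r : α → α → Prop} {p : α → Prop}
    {l : List α} (hl : l.IsChain r) (hp : ∀ x y, p x → r x y → p y) (hne : l ≠ [])
    (hhead : p (l.head hne)) : p (l.getLast hne) :=
  hl.induction p l (fun _ _ hr hx => hp _ _ hx hr) (fun _ => hhead) _ (l.getLast_mem hne)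

/-- Relational soundness of the inductive assertion method via a weakly adequate
pre-product: an inductive annotation of the product implies that the pair A, A'
satisfies the relational spec ⟨R,S⟩. -/
theorem iam_relational_sound
    (A : Automaton Ctrl Sto) (A' : Automaton Ctrl' Sto')
    (P : Automaton (Ctrl × Ctrl') (Sto × Sto'))
    (hpre : IsPreProduct A A' P) (hwa : WeaklyAdequate A A' P)
    (R S : Sto → Sto' → Prop)
    (anno : Ctrl × Ctrl' → Sto × Sto' → Prop)
    (hinit : ∀ (s : Sto) (s' : Sto'), R s s' → anno (A.init, A'.init) (s, s'))
    (hfin : ∀ (s : Sto) (s' : Sto'), anno (A.fin, A'.fin) (s, s') → S s s')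
    (hclosed : ∀ γ β : (Ctrl × Ctrl') × (Sto × Sto'),
        anno γ.1 γ.2 → P.step γ β → anno β.1 β.2) :
    RelSat A A' R S := by
  intro τ τ' hτ hτ' h h' hR hl hl'
  obtain ⟨T, ⟨hT, hchain, hhead⟩, hleft, hright⟩ := hwa τ τ' hτ hτ'
    ⟨τ, ⟨hτ, fun _ => hl⟩, List.prefix_rfl⟩ ⟨τ', ⟨hτ', fun _ => hl'⟩, List.prefix_rfl⟩
  obtain ⟨hPinit, -, hstep⟩ := hpre
  have hchainL : List.IsChain (fun x y => A.step x y ∨ x = y) (T.map leftSt) :=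
    List.isChain_map_of_isChain leftSt (fun γ β hγβ => by grind) hchain
  have hchainR : List.IsChain (fun x y => A'.step x y ∨ x = y) (T.map rightSt) :=
    List.isChain_map_of_isChain rightSt (fun γ β hγβ => by grind) hchain
  obtain ⟨hL₀, hL₁⟩ := head_getLast_eq_of_prefix_destutter hchainL hleft h (by simpa using hT)
    fun _ hs => A.finality hs hl
  obtain ⟨hR₀, hR₁⟩ := head_getLast_eq_of_prefix_destutter hchainR hright h' (by simpa using hT)
    fun _ hs => A'.finality hs hl'
  rw [List.head_map] at hL₀ hR₀
  rw [List.getLast_map] at hL₁ hR₁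
  have hanno₀ : anno (T.head hT).1 (T.head hT).2 := by
    rw [hhead hT, hPinit]
    rw [hL₀, hR₀] at hR
    exact hinit _ _ hR
  have hanno₁ : anno (T.getLast hT).1 (T.getLast hT).2 :=
    List.IsChain.getLast_of_head (p := fun γ => anno γ.1 γ.2) hchain hclosed hT hanno₀
  rw [hL₁] at hl ⊢
  rw [hR₁] at hl' ⊢
  have hc : (T.getLast hT).1 = (A.fin, A'.fin) := Prod.ext hl hl'
  rw [hc] at hanno₁
  exact hfin _ _ hanno₁
end
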